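/- Let φ be an injective ℂ-algebra endomorphism of ℂ[x,y] which is not an automorphism. If φ(p) = p for some non-constant polynomial p ∈ ℂ[x,y], then p belongs to a proper retract of ℂ[x,y]. -/

import Mathlib

open MvPolynomial

/-- `ℂ[x,y]` as multivariate polynomials in two variables. -/
local notation "P" => MvPolynomial (Fin 2) ℂ

/-- A retract of `ℂ[x,y]`: the image of an idempotent `ℂ`-algebra endomorphism. -/
def IsRetract (R : Subalgebra ℂ P) : Prop :=
  ∃ π : P →ₐ[ℂ] P, π.comp π = π ∧ π.range = R

/-- A proper retract: a retract different from `ℂ` and from `ℂ[x,y]`. -/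
def IsProperRetract (R : Subalgebra ℂ P) : Prop :=
  IsRetract R ∧ R ≠ ⊥ ∧ R ≠ ⊤

/-- The homogenization `x ↦ x T`, `y ↦ y T`. -/
noncomputable def homogenize : P →ₐ[ℂ] Polynomial (FractionRing P) :=
  aeval fun i => Polynomial.C (algebraMap P (FractionRing P) (X i)) * Polynomial.X

theorem coeff_homogenize (f : P) (n : ℕ) :
    (homogenize f).coeff n = algebraMap P (FractionRing P) (homogeneousComponent n f) := by
  induction f using MvPolynomial.induction_on' with
  | monomial s c =>
    have h1 : homogenize (monomial s c) =
        Polynomial.monomial (s 0 + s 1) (algebraMap P (FractionRing P) (monomial s c)) := by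
      have h2 : (monomial s c : P) = C c * (X 0 ^ s 0 * X 1 ^ s 1) := by
        rw [monomial_eq, Finsupp.prod_fintype _ _ (by simp)]
        simp
      rw [h2, homogenize, map_mul, map_mul, map_pow, map_pow, aeval_X, aeval_X,
        ← algebraMap_eq, AlgHom.commutes, ← Polynomial.C_mul_X_pow_eq_monomial]
      simp only [map_mul, map_pow, ← IsScalarTower.algebraMap_apply]
      rw [Polynomial.algebraMap_apply]
      ring
    rw [h1, Polynomial.coeff_monomial]
    have h3 : (monomial s c : P) ∈ homogeneousSubmodule (Fin 2) ℂ (s 0 + s 1) := by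
      rw [mem_homogeneousSubmodule]
      apply isHomogeneous_monomial
      rw [Finsupp.degree_eq_sum, Fin.sum_univ_two]
    rw [homogeneousComponent_of_mem h3]
    by_cases h : n = s 0 + s 1
    · simp [h]
    · simp [h, Ne.symm h]
  | add p q hp hq => simp [hp, hq]

theorem natDegree_homogenize (f : P) : (homogenize f).natDegree = f.totalDegree := by
  apply le_antisymm
  · rw [Polynomial.natDegree_le_iff_coeff_eq_zero]
    intro n hn
    rw [coeff_homogenize, homogeneousComponent_eq_zero _ _ hn, map_zero]
  · by_cases hf : f = 0
    · simp [hf]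
    apply Polynomial.le_natDegree_of_ne_zero
    rw [coeff_homogenize, Ne, FaithfulSMul.algebraMap_eq_zero_iff]
    obtain ⟨s, hs, h⟩ := Finset.exists_mem_eq_sup f.support (support_nonempty.2 hf)
      (fun s => s.sum fun _ e => e)
    intro h0
    have := congrArg (coeff s) h0
    rw [coeff_homogeneousComponent, coeff_zero] at this
    have hd : s.degree = f.totalDegree := h.symm
    rw [if_pos hd] at this
    exact mem_support_iff.1 hs this

theorem homogenize_injective : Function.Injective homogenize := by
  rw [injective_iff_map_eq_zero]
  intro f hf
  rw [← sum_homogeneousComponent f]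
  apply Finset.sum_eq_zero
  intro i _
  have := coeff_homogenize f i
  rw [hf, Polynomial.coeff_zero, eq_comm, FaithfulSMul.algebraMap_eq_zero_iff] at this
  exact this

theorem totalDegree_pderiv_le (i : Fin 2) (f : P) : (pderiv i f).totalDegree ≤ f.totalDegree := by
  refine Finset.sup_le fun s hs => ?_
  rw [mem_support_iff, coeff_pderiv] at hs
  refine le_trans ?_ (le_totalDegree (mem_support_iff.2 (left_ne_zero_of_mul hs)))
  rw [Finsupp.sum_add_index' (by simp) (by simp)]
  exact Nat.le_add_right _ _

/-- The Jacobian derivation `h ↦ det ∂(f, h) / ∂(x, y)`. -/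
noncomputable def jacobianDerivation (f : P) : Derivation ℂ P P :=
  pderiv 0 f • pderiv 1 - pderiv 1 f • pderiv 0

theorem jacobianDerivation_apply (f h : P) :
    jacobianDerivation f h = pderiv 0 f * pderiv 1 h - pderiv 1 f * pderiv 0 h := rfl

theorem totalDegree_jacobianDerivation_le (f h : P) :
    (jacobianDerivation f h).totalDegree ≤ f.totalDegree + h.totalDegree := by
  rw [jacobianDerivation_apply]
  refine (totalDegree_sub _ _).trans (max_le ?_ ?_) <;>
  exact (totalDegree_mul _ _).trans
    (add_le_add (totalDegree_pderiv_le _ _) (totalDegree_pderiv_le _ _))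

theorem derivation_apply_algHom (D : Derivation ℂ P P) (ψ : P →ₐ[ℂ] P) (q : P) :
    D (ψ q) = ψ (pderiv 0 q) * D (ψ (X 0)) + ψ (pderiv 1 q) * D (ψ (X 1)) := by
  induction q using MvPolynomial.induction_on with
  | C a => simp [← algebraMap_eq]
  | add p q hp hq => simp only [map_add, hp, hq]; ring
  | mul_X p i hp =>
    fin_cases i <;> simp [hp, Derivation.leibniz, pderiv_X] <;> ring

/-- A derivation of a domain of characteristic zero vanishing on a subalgebra over which the
domain is algebraic is zero. -/
theorem derivation_eq_zero_of_isAlgebraic {k A : Type*} [Field k] [CommRing A] [IsDomain A]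
    [CharZero A] [Algebra k A] (S : Subalgebra k A) [Algebra.IsAlgebraic S A]
    (D : Derivation k A A) (hD : ∀ s ∈ S, D s = 0) : D = 0 := by
  let D' : Derivation S A A :=
    { toFun := D
      map_add' := map_add D
      map_smul' := fun r a => by
        simp [Algebra.smul_def, Derivation.leibniz, hD]
      map_one_eq_zero' := by simp
      leibniz' := D.leibniz }
  ext a
  have hex : ∃ n, ∃ p : Polynomial S, p ≠ 0 ∧ Polynomial.aeval a p = 0 ∧ p.natDegree = n := by
    obtain ⟨p, hp, hpa⟩ := Algebra.IsAlgebraic.isAlgebraic (R := S) a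
    exact ⟨_, p, hp, hpa, rfl⟩
  classical
  obtain ⟨p, hp, hpa, hn⟩ := Nat.find_spec hex
  have hd : p.natDegree ≠ 0 := by
    intro h0
    rw [Polynomial.eq_C_of_natDegree_eq_zero h0, Polynomial.aeval_C] at hpa
    rw [FaithfulSMul.algebraMap_eq_zero_iff] at hpa
    apply hp
    rw [Polynomial.eq_C_of_natDegree_eq_zero h0, hpa, Polynomial.C_0]
  have hlt : p.derivative.natDegree < Nat.find hex := by
    rw [← hn]
    exact Polynomial.natDegree_derivative_lt hd
  have : CharZero S := ⟨fun m n h => Nat.cast_injective (R := A) (by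
    simpa using congrArg (algebraMap S A) h)⟩
  have hne : Polynomial.aeval a p.derivative ≠ 0 := by
    intro h0
    refine Nat.find_min hex hlt ⟨p.derivative, ?_, h0, rfl⟩
    intro h
    exact hd (Polynomial.derivative_eq_zero.1 h)
  have h := D'.map_aeval p a
  rw [hpa, map_zero, eq_comm, smul_eq_mul] at h
  exact (mul_eq_zero.1 h).resolve_left hne

theorem jacobianDerivation_ne_zero {ψ : P →ₐ[ℂ] P} (hψ : Function.Injective ψ) :
    jacobianDerivation (ψ (X 0)) (ψ (X 1)) ≠ 0 := by
  intro h0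
  have hself : jacobianDerivation (ψ (X 0)) (ψ (X 0)) = 0 := by
    rw [jacobianDerivation_apply]; ring
  have hai : AlgebraicIndependent ℂ fun i : Fin 2 => ψ (X i) := by
    have : (aeval fun i : Fin 2 => ψ (X i)) = ψ := by ext i; simp
    rw [AlgebraicIndependent, this]
    exact hψ
  have htb := hai.isTranscendenceBasis_of_trdeg_le_of_finite (by
    rw [MvPolynomial.trdeg_of_isDomain]; simp)
  have := htb.isAlgebraic
  have hD : jacobianDerivation (ψ (X 0)) = 0 := by
    apply derivation_eq_zero_of_isAlgebraic (Algebra.adjoin ℂ (Set.range fun i => ψ (X i)))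
    intro s hs
    induction hs using Algebra.adjoin_induction with
    | mem x hx =>
      obtain ⟨i, rfl⟩ := hx
      fin_cases i
      exacts [hself, h0]
    | algebraMap r => simp
    | add x y _ _ hx hy => simp [hx, hy]
    | mul x y _ _ hx hy => simp [hx, hy]
  have e1 : pderiv 0 (ψ (X 0)) = 0 := by
    have := congrArg (fun D : Derivation ℂ P P => D (X 1)) hD
    simpa [jacobianDerivation_apply, pderiv_X] using this
  have e2 : pderiv 1 (ψ (X 0)) = 0 := by
    have := congrArg (fun D : Derivation ℂ P P => D (X 0)) hD
    simpa [jacobianDerivation_apply, pderiv_X] using this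
  have hconst : ψ (X 0) = ψ (C (coeff 0 (ψ (X 0)))) := by
    rw [← algebraMap_eq, AlgHom.commutes, algebraMap_eq]
    ext s
    rw [coeff_C]
    split_ifs with hs
    · rw [hs]
    · have key : ∀ i, pderiv i (ψ (X 0)) = 0 → s i ≠ 0 → coeff s (ψ (X 0)) = 0 := by
        intro i hi hsi
        have := coeff_pderiv (i := i) (ψ (X 0)) (s - Finsupp.single i 1)
        rw [hi, coeff_zero, tsub_add_cancel_of_le (by simpa using Nat.one_le_iff_ne_zero.2 hsi)]
          at this
        rcases mul_eq_zero.1 this.symm with h | h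
        · exact h
        · exfalso; norm_cast at h
      by_contra hc
      apply hs
      ext i
      by_contra hi
      fin_cases i
      · exact hc (key 0 e1 (Ne.symm hi))
      · exact hc (key 1 e2 (Ne.symm hi))
  have := congrArg totalDegree (hψ hconst)
  simp at this

theorem totalDegree_pderiv_one_le {ψ : P →ₐ[ℂ] P} (hψ : Function.Injective ψ) (q : P) :
    (ψ (pderiv 1 q)).totalDegree ≤ (ψ q).totalDegree + (ψ (X 0)).totalDegree := by
  by_cases h : ψ (pderiv 1 q) = 0
  · simp [h]
  have h1 := totalDegree_jacobianDerivation_le (ψ (X 0)) (ψ q)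
  rw [derivation_apply_algHom, show jacobianDerivation (ψ (X 0)) (ψ (X 0)) = 0 by
    rw [jacobianDerivation_apply]; ring, mul_zero, zero_add,
    totalDegree_mul_of_isDomain h (jacobianDerivation_ne_zero hψ)] at h1
  omega

theorem totalDegree_iterate_pderiv_one_le {ψ : P →ₐ[ℂ] P} (hψ : Function.Injective ψ) (q : P)
    (m : ℕ) :
    (ψ ((pderiv 1)^[m] q)).totalDegree ≤ (ψ q).totalDegree + m * (ψ (X 0)).totalDegree := by
  induction m with
  | zero => simp
  | succ m ih =>
    rw [Function.iterate_succ_apply', add_one_mul, ← add_assoc]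
    exact (totalDegree_pderiv_one_le hψ _).trans (by omega)

theorem iterate_derivative_eval_ne_zero {K : Type*} [Field K] [CharZero K] {t : K}
    {R : Polynomial K} (m : ℕ) (hR : R.eval t ≠ 0) :
    (Polynomial.derivative^[m] (R * (Polynomial.X - Polynomial.C t) ^ m)).eval t ≠ 0 := by
  have hR0 : R ≠ 0 := by rintro rfl; simp at hR
  have hp : R * (Polynomial.X - Polynomial.C t) ^ m ≠ 0 :=
    mul_ne_zero hR0 (pow_ne_zero _ (Polynomial.X_sub_C_ne_zero t))
  have hm : (R * (Polynomial.X - Polynomial.C t) ^ m).rootMultiplicity t = m := by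
    rw [Polynomial.rootMultiplicity_mul_X_sub_C_pow hR0,
      Polynomial.rootMultiplicity_eq_zero hR, zero_add]
  have h := Polynomial.eval_iterate_derivative_rootMultiplicity
    (p := R * (Polynomial.X - Polynomial.C t) ^ m) (t := t)
  have h' := Polynomial.eval_divByMonic_pow_rootMultiplicity_ne_zero t hp
  rw [hm] at h h'
  rw [h, nsmul_eq_mul]
  exact mul_ne_zero (Nat.cast_ne_zero.2 m.factorial_ne_zero) h'

theorem aeval_iterate_pderiv_one {K : Type*} [Field K] [Algebra ℂ K] (α β : K) (r : P) (m : ℕ) :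
    aeval ![α, β] ((pderiv 1)^[m] r) = (Polynomial.derivative^[m]
      (aeval ![Polynomial.C α, (Polynomial.X : Polynomial K)] r)).eval β := by
  have h1 : ∀ q : P, aeval ![Polynomial.C α, (Polynomial.X : Polynomial K)] (pderiv 1 q) =
      Polynomial.derivative (aeval ![Polynomial.C α, (Polynomial.X : Polynomial K)] q) := by
    intro q
    induction q using MvPolynomial.induction_on with
    | C a => simp [← algebraMap_eq, Polynomial.algebraMap_apply]
    | add p q hp hq => simp only [map_add, hp, hq]
    | mul_X p i hp =>
      fin_cases i <;> simp [hp, Derivation.leibniz, pderiv_X] <;> ring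
  have h2 : ∀ q : P, (aeval ![Polynomial.C α, (Polynomial.X : Polynomial K)] q).eval β =
      aeval ![α, β] q := by
    intro q
    induction q using MvPolynomial.induction_on with
    | C a => simp [← algebraMap_eq, Polynomial.algebraMap_apply]
    | add p q hp hq => simp only [map_add, Polynomial.eval_add, hp, hq]
    | mul_X p i hp =>
      fin_cases i <;> simp [hp]
  have h3 : aeval ![Polynomial.C α, (Polynomial.X : Polynomial K)] ((pderiv 1)^[m] r) =
      Polynomial.derivative^[m] (aeval ![Polynomial.C α, (Polynomial.X : Polynomial K)] r) := by
    induction m with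
    | zero => rfl
    | succ m ih => rw [Function.iterate_succ_apply', Function.iterate_succ_apply', h1, ih]
  rw [← h3, h2]

/-- For a polynomial that is homogeneous for the coprime weights `(a, b)`, the order of vanishing
along the second variable at a point with nonzero coordinates is at most `1 / a` times its degree
in that variable. -/
theorem exists_aeval_iterate_pderiv_one_ne_zero {K : Type*} [Field K] [Algebra ℂ K] {α β : K}
    (hα : α ≠ 0) (hβ : β ≠ 0) {a b : ℕ} (hab : a.Coprime b) (ha : 0 < a)
    {r : P} (hr : r ≠ 0) {w : ℕ} (hw : ∀ s ∈ r.support, s 0 * a + s 1 * b = w) :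
    ∃ m, (m = 0 ∨ ∃ c : ℂ, β ^ a = algebraMap ℂ K c * α ^ b) ∧
      (∃ s ∈ r.support, a * m ≤ s 1) ∧ aeval ![α, β] ((pderiv 1)^[m] r) ≠ 0 := by
  have : CharZero K := charZero_of_injective_algebraMap (algebraMap ℂ K).injective
  obtain ⟨t, ht, htmin⟩ := Finset.exists_min_image r.support (fun s => s 1) (support_nonempty.2 hr)
  have hk : ∀ s ∈ r.support, ∃ k, s 1 = t 1 + a * k ∧ t 0 = s 0 + b * k := by
    intro s hs
    obtain ⟨e, he⟩ := Nat.exists_eq_add_of_le (htmin s hs)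
    have h1 := hw s hs
    rw [← hw t ht, he] at h1
    have hle : s 0 ≤ t 0 := by
      by_contra hlt
      have := Nat.mul_lt_mul_of_pos_right (not_le.1 hlt) ha
      nlinarith [Nat.zero_le (e * b)]
    obtain ⟨e', he'⟩ := Nat.exists_eq_add_of_le hle
    rw [he'] at h1
    have h2 : e * b = e' * a := by linarith
    obtain ⟨k, rfl⟩ : a ∣ e := hab.dvd_of_dvd_mul_right ⟨e', by rw [h2, mul_comm]⟩
    refine ⟨k, he, ?_⟩
    have : e' = b * k := Nat.eq_of_mul_eq_mul_right ha (by rw [← h2]; ring)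
    rw [he', this]
  choose! k hk1 hk0 using hk
  set h : Polynomial ℂ := ∑ s ∈ r.support, Polynomial.monomial (k s) (coeff s r) with hh
  have hcoeff : ∀ n, h.coeff n ≠ 0 → ∃ s ∈ r.support, k s = n := by
    intro n hn
    rw [hh, Polynomial.finsetSum_coeff] at hn
    obtain ⟨s, hs, hsn⟩ := Finset.exists_ne_zero_of_sum_ne_zero hn
    rw [Polynomial.coeff_monomial] at hsn
    exact ⟨s, hs, (ite_ne_right_iff.1 hsn).1⟩
  have hkinj : ∀ s ∈ r.support, ∀ s' ∈ r.support, k s = k s' → s = s' := by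
    intro s hs s' hs' hss
    ext i
    have e1 := hk1 s hs
    have e2 := hk1 s' hs'
    have e3 := hk0 s hs
    have e4 := hk0 s' hs'
    rw [hss] at e1 e3
    fin_cases i <;> simp only [Fin.zero_eta, Fin.mk_one] <;> omega
  have hh0 : h ≠ 0 := by
    intro h0
    have := congrArg (fun q => Polynomial.coeff q (k t)) h0
    simp only [hh, Polynomial.finsetSum_coeff, Polynomial.coeff_zero] at this
    rw [Finset.sum_eq_single t] at this
    · rw [Polynomial.coeff_monomial, if_pos rfl] at this
      exact mem_support_iff.1 ht this
    · intro s hs hst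
      rw [Polynomial.coeff_monomial, if_neg fun e => hst (hkinj s hs t ht e)]
    · exact fun h => (h ht).elim
  have hdeg : ∃ s ∈ r.support, k s = h.natDegree :=
    hcoeff _ (by simpa using hh0)
  set G : Polynomial K := Polynomial.C (α ^ b)⁻¹ * Polynomial.X ^ a with hG
  have hH : aeval ![Polynomial.C α, (Polynomial.X : Polynomial K)] r =
      Polynomial.C (α ^ t 0) * Polynomial.X ^ t 1 * Polynomial.aeval G h := by
    rw [aeval_def, eval₂_eq', hh, map_sum, Finset.mul_sum]
    refine Finset.sum_congr rfl fun s hs => ?_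
    rw [Fin.prod_univ_two, Polynomial.aeval_monomial, hk1 s hs, hk0 s hs, hG]
    simp only [Matrix.cons_val_zero, Matrix.cons_val_one, mul_pow, ← Polynomial.C_pow]
    have : (Polynomial.C (α ^ s 0) : Polynomial K) =
        Polynomial.C (α ^ (s 0 + b * k s)) * Polynomial.C ((α ^ b)⁻¹ ^ k s) := by
      rw [← Polynomial.C_mul]
      rw [pow_add, pow_mul, inv_pow, mul_assoc,
        mul_inv_cancel₀ (pow_ne_zero _ (pow_ne_zero _ hα)), mul_one]
    rw [this]
    ring
  have hGβ : G.eval β = β ^ a / α ^ b := by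
    rw [hG]; simp; field_simp
  have hbase : (Polynomial.C (α ^ t 0) * Polynomial.X ^ t 1).eval β ≠ 0 := by
    simp [hα, hβ]
  simp_rw [aeval_iterate_pderiv_one, hH]
  by_cases hu : ∃ c : ℂ, β ^ a / α ^ b = algebraMap ℂ K c
  · obtain ⟨c, hc⟩ := hu
    obtain ⟨h₁, hfac, hndvd⟩ := h.exists_eq_pow_rootMultiplicity_mul_and_not_dvd hh0 c
    refine ⟨h.rootMultiplicity c, Or.inr ⟨c, by rw [← hc]; field_simp⟩, ?_, ?_⟩
    · obtain ⟨s, hs, hsk⟩ := hdeg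
      refine ⟨s, hs, ?_⟩
      rw [hk1 s hs, hsk]
      have hle := Polynomial.natDegree_le_of_dvd (h.pow_rootMultiplicity_dvd c) hh0
      rw [Polynomial.natDegree_pow, Polynomial.natDegree_X_sub_C, mul_one] at hle
      exact (Nat.mul_le_mul_left a hle).trans (Nat.le_add_left _ _)
    · set m := h.rootMultiplicity c
      have hroot : (G - Polynomial.C (algebraMap ℂ K c)).IsRoot β := by
        simp [Polynomial.IsRoot, hGβ, hc]
      obtain ⟨Q, hQ⟩ := Polynomial.dvd_iff_isRoot.2 hroot
      have hQβ : Q.eval β ≠ 0 := by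
        have := congrArg (fun q => (Polynomial.derivative q).eval β) hQ
        simp only [hG, Polynomial.derivative_sub,
          Polynomial.derivative_X_pow, Polynomial.derivative_mul] at this
        simp at this
        rw [← this]
        simp [hα, hβ, ha.ne']
      have hh₁ : (Polynomial.aeval G h₁).eval β ≠ 0 := by
        have : (Polynomial.aeval G h₁).eval β = algebraMap ℂ K (h₁.eval c) := by
          rw [← Polynomial.coe_evalRingHom, Polynomial.aeval_def, Polynomial.hom_eval₂,
            Polynomial.coe_evalRingHom, hGβ, hc]
          have : (Polynomial.evalRingHom β).comp (algebraMap ℂ (Polynomial K)) =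
            algebraMap ℂ K := by ext z; simp [Polynomial.algebraMap_apply]
          rw [this, Polynomial.eval₂_at_apply]
        rw [this, Ne, FaithfulSMul.algebraMap_eq_zero_iff]
        exact fun h0 => hndvd (Polynomial.dvd_iff_isRoot.2 h0)
      have e : Polynomial.C (α ^ t 0) * Polynomial.X ^ t 1 * Polynomial.aeval G h =
          (Polynomial.C (α ^ t 0) * Polynomial.X ^ t 1 * Q ^ m * Polynomial.aeval G h₁) *
            (Polynomial.X - Polynomial.C β) ^ m := by
        rw [hfac, map_mul, map_pow (Polynomial.aeval G), map_sub, Polynomial.aeval_X, Polynomial.aeval_C,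
          Polynomial.algebraMap_apply, hQ, mul_pow]
        ring
      rw [e]
      apply iterate_derivative_eval_ne_zero
      rw [Polynomial.eval_mul, Polynomial.eval_mul, Polynomial.eval_pow]
      exact mul_ne_zero (mul_ne_zero hbase (pow_ne_zero _ hQβ)) hh₁
  · refine ⟨0, Or.inl rfl, ⟨t, ht, by simp⟩, ?_⟩
    rw [Function.iterate_zero_apply, Polynomial.eval_mul]
    refine mul_ne_zero hbase fun h0 => hu ?_
    have h1 : Polynomial.aeval (β ^ a / α ^ b) h = 0 := by
      rw [← h0, ← Polynomial.coe_evalRingHom, Polynomial.aeval_def, Polynomial.aeval_def,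
        Polynomial.hom_eval₂, Polynomial.coe_evalRingHom, hGβ]
      congr 1
      ext z
      simp [Polynomial.algebraMap_apply]
    have h2 : IsAlgebraic ℂ (β ^ a / α ^ b) := ⟨h, hh0, h1⟩
    have : Algebra.IsAlgebraic ℂ (IntermediateField.adjoin ℂ {β ^ a / α ^ b}) :=
      IntermediateField.isAlgebraic_adjoin_simple h2.isIntegral
    have hbot := IntermediateField.eq_bot_of_isAlgClosed_of_isAlgebraic
      (IntermediateField.adjoin ℂ {β ^ a / α ^ b})
    rw [IntermediateField.adjoin_simple_eq_bot_iff] at hbot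
    obtain ⟨c, hc⟩ := IntermediateField.mem_bot.1 hbot
    exact ⟨c, hc.symm⟩

theorem weight_fin_two (d e : ℕ) (s : Fin 2 →₀ ℕ) :
    Finsupp.weight ![d, e] s = s 0 * d + s 1 * e := by
  rw [Finsupp.weight_apply, Finsupp.sum_fintype _ _ (by simp), Fin.sum_univ_two]
  simp

theorem coeff_algHom_eq_aeval_weightedHomogeneousComponent {K : Type*} [Field K] [Algebra ℂ K]
    (χ : P →ₐ[ℂ] Polynomial K) {d e : ℕ} (hd : (χ (X 0)).natDegree = d)
    (he : (χ (X 1)).natDegree = e) {w : ℕ} {q : P}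
    (hq : ∀ s ∈ q.support, s 0 * d + s 1 * e ≤ w) :
    (χ q).coeff w = aeval ![(χ (X 0)).leadingCoeff, (χ (X 1)).leadingCoeff]
      (weightedHomogeneousComponent ![d, e] w q) := by
  have hχ : χ = aeval fun i => χ (X i) := by ext i; simp
  have hχq : χ q = ∑ s ∈ q.support,
      Polynomial.C (algebraMap ℂ K (coeff s q)) * (χ (X 0) ^ s 0 * χ (X 1) ^ s 1) := by
    conv_lhs => rw [hχ, aeval_def, eval₂_eq']
    simp [Fin.prod_univ_two, Polynomial.algebraMap_apply]
  rw [hχq, Polynomial.finsetSum_coeff, weightedHomogeneousComponent_apply, map_sum,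
    Finset.sum_filter]
  refine Finset.sum_congr rfl fun s hs => ?_
  rw [Polynomial.coeff_C_mul, weight_fin_two]
  have h0 : (χ (X 0) ^ s 0).natDegree ≤ s 0 * d := Polynomial.natDegree_pow_le_of_le _ hd.le
  have h1 : (χ (X 1) ^ s 1).natDegree ≤ s 1 * e := Polynomial.natDegree_pow_le_of_le _ he.le
  split_ifs with hw
  · rw [← hw, Polynomial.coeff_mul_add_eq_of_natDegree_le h0 h1,
      Polynomial.coeff_pow_of_natDegree_le hd.le, Polynomial.coeff_pow_of_natDegree_le he.le,
      aeval_monomial, Finsupp.prod_fintype _ _ (by simp), Fin.prod_univ_two]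
    simp [Polynomial.leadingCoeff, hd, he]
  · rw [Polynomial.coeff_eq_zero_of_natDegree_lt, mul_zero]
    exact (Polynomial.natDegree_mul_le_of_le h0 h1).trans_lt (lt_of_le_of_ne (hq s hs) hw)

theorem iterate_pderiv_one_weightedHomogeneousComponent (d e w m : ℕ) (q : P) :
    (pderiv 1)^[m] (weightedHomogeneousComponent ![d, e] (w + m * e) q) =
      weightedHomogeneousComponent ![d, e] w ((pderiv 1)^[m] q) := by
  induction m generalizing w with
  | zero => simp
  | succ m ih =>
    rw [Function.iterate_succ_apply', Function.iterate_succ_apply', add_one_mul,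
      add_comm (m * e), ← add_assoc, ih]
    ext s
    simp only [coeff_pderiv, coeff_weightedHomogeneousComponent, weight_fin_two]
    have : (s + Finsupp.single 1 1 : Fin 2 →₀ ℕ) 0 * d +
        (s + Finsupp.single 1 1 : Fin 2 →₀ ℕ) 1 * e = w + e ↔ s 0 * d + s 1 * e = w := by
      simp only [Finsupp.add_apply, Finsupp.single_apply]
      simp only [one_ne_zero, if_true, if_false, add_zero, add_one_mul]
      omega
    simp only [this]
    split_ifs <;> simp

theorem weight_le_of_mem_support_iterate_pderiv_one {d e w : ℕ} {q : P}
    (hq : ∀ s ∈ q.support, s 0 * d + s 1 * e ≤ w) (m : ℕ) :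
    ∀ s ∈ ((pderiv 1)^[m] q).support, s 0 * d + s 1 * e + m * e ≤ w := by
  induction m with
  | zero => simpa using hq
  | succ m ih =>
    intro s hs
    rw [Function.iterate_succ_apply', mem_support_iff, coeff_pderiv] at hs
    have := ih _ (mem_support_iff.2 (left_ne_zero_of_mul hs))
    simp only [Finsupp.add_apply, Finsupp.single_apply] at this
    simp only [one_ne_zero, if_true, if_false, add_zero, add_one_mul] at this
    linarith

theorem totalDegree_algHom_X_pos {ψ : P →ₐ[ℂ] P} (hψ : Function.Injective ψ) (i : Fin 2) :
    0 < (ψ (X i)).totalDegree := by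
  rw [Nat.pos_iff_ne_zero]
  intro h0
  rw [totalDegree_eq_zero_iff_eq_C, ← algebraMap_eq, ← AlgHom.commutes ψ] at h0
  have := congrArg totalDegree (hψ h0)
  simp at this

theorem totalDegree_sub_C_mul_pow_lt {f g : P} {c : ℂ} {k : ℕ} (hg : 0 < g.totalDegree)
    (hdeg : g.totalDegree = k * f.totalDegree)
    (h : (homogenize g).leadingCoeff = algebraMap ℂ _ c * (homogenize f).leadingCoeff ^ k) :
    (g - C c * f ^ k).totalDegree < g.totalDegree := by
  have hpow : (homogenize f ^ k).natDegree ≤ k * f.totalDegree :=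
    Polynomial.natDegree_pow_le_of_le _ (natDegree_homogenize f).le
  have e : homogenize (g - C c * f ^ k) =
      homogenize g - Polynomial.C (algebraMap ℂ _ c) * homogenize f ^ k := by
    rw [map_sub, map_mul, map_pow, ← algebraMap_eq, AlgHom.commutes, Polynomial.algebraMap_apply]
  have hle : (homogenize (g - C c * f ^ k)).natDegree ≤ g.totalDegree := by
    rw [e]
    refine Polynomial.natDegree_sub_le_of_le (natDegree_homogenize g).le ?_ |>.trans_eq
      (max_self _)
    exact (Polynomial.natDegree_C_mul_le _ _).trans (hpow.trans_eq hdeg.symm)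
  have hc : (homogenize (g - C c * f ^ k)).coeff g.totalDegree = 0 := by
    rw [e, Polynomial.coeff_sub, Polynomial.coeff_C_mul]
    nth_rewrite 2 [hdeg]
    rw [Polynomial.coeff_pow_of_natDegree_le (natDegree_homogenize f).le]
    rw [Polynomial.leadingCoeff, Polynomial.leadingCoeff, natDegree_homogenize,
      natDegree_homogenize] at h
    rw [h, sub_self]
  rw [← natDegree_homogenize (g - C c * f ^ k)]
  refine lt_of_le_of_ne hle fun h0 => ?_
  rw [← h0, Polynomial.coeff_natDegree, Polynomial.leadingCoeff_eq_zero] at hc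
  rw [hc, Polynomial.natDegree_zero] at h0
  omega

/-- If the images of the variables under `ψ` have no elementary reduction, then the degree of
`ψ q` is at least one sixth of the weighted degree of `q`. -/
theorem weight_le_six_mul_totalDegree {ψ : P →ₐ[ℂ] P} (hψ : Function.Injective ψ)
    (hred₀ : ∀ (c : ℂ) (k : ℕ),
      (ψ (X 0)).totalDegree ≤ (ψ (X 0) - C c * ψ (X 1) ^ k).totalDegree)
    (hred₁ : ∀ (c : ℂ) (k : ℕ),
      (ψ (X 1)).totalDegree ≤ (ψ (X 1) - C c * ψ (X 0) ^ k).totalDegree)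
    (q : P) : ∀ s ∈ q.support,
      s 0 * (ψ (X 0)).totalDegree + s 1 * (ψ (X 1)).totalDegree ≤ 6 * (ψ q).totalDegree := by
  intro s₀ hs₀
  obtain ⟨t, ht, htmax⟩ := Finset.exists_max_image q.support
    (fun s => s 0 * (ψ (X 0)).totalDegree + s 1 * (ψ (X 1)).totalDegree) ⟨s₀, hs₀⟩
  refine (htmax s₀ hs₀).trans ?_
  have hd := totalDegree_algHom_X_pos hψ 0
  have he := totalDegree_algHom_X_pos hψ 1
  set d := (ψ (X 0)).totalDegree with hd_def
  set e := (ψ (X 1)).totalDegree with he_def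
  set w := t 0 * d + t 1 * e with hw
  obtain ⟨a, b, hab, hda, heb⟩ := Nat.exists_coprime d e
  set g := Nat.gcd d e
  have hg : 0 < g := Nat.gcd_pos_of_pos_left _ hd
  have ha : 0 < a := Nat.pos_of_mul_pos_right (hda ▸ hd)
  have hb : 0 < b := Nat.pos_of_mul_pos_right (heb ▸ he)
  have hwt : ∀ s : Fin 2 →₀ ℕ, s 0 * d + s 1 * e = (s 0 * a + s 1 * b) * g := by
    intro s; rw [hda, heb]; ring
  set r := weightedHomogeneousComponent ![d, e] w q with hr
  have hcr : ∀ s, coeff s r = if s 0 * d + s 1 * e = w then coeff s q else 0 := by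
    intro s
    rw [hr, coeff_weightedHomogeneousComponent, weight_fin_two]
  have hr0 : r ≠ 0 := by
    intro h0
    have := hcr t
    rw [h0, coeff_zero, if_pos rfl] at this
    exact mem_support_iff.1 ht this.symm
  have hrw : ∀ s ∈ r.support, s 0 * d + s 1 * e = w := by
    intro s hs
    rw [mem_support_iff, hcr] at hs
    exact (ite_ne_right_iff.1 hs).1
  have hrw' : ∀ s ∈ r.support, s 0 * a + s 1 * b = t 0 * a + t 1 * b := by
    intro s hs
    have := hrw s hs
    rw [hw, hwt, hwt] at this
    exact Nat.eq_of_mul_eq_mul_right hg this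
  have hlc : ∀ i, (homogenize (ψ (X i))).leadingCoeff ≠ 0 := by
    intro i
    rw [Ne, Polynomial.leadingCoeff_eq_zero, map_eq_zero_iff _ homogenize_injective,
      map_eq_zero_iff _ hψ]
    exact X_ne_zero i
  obtain ⟨m, hm, ⟨s, hs, hms⟩, hne⟩ :=
    exists_aeval_iterate_pderiv_one_ne_zero (hlc 0) (hlc 1) hab ha hr0 hrw'
  have hmw : a * m * e ≤ w :=
    (Nat.mul_le_mul_right e hms).trans ((Nat.le_add_left _ _).trans_eq (hrw s hs))
  have hmew : m * e ≤ w := by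
    refine le_trans (Nat.mul_le_mul_right e ?_) hmw
    exact Nat.le_mul_of_pos_left m ha
  obtain ⟨v, hv⟩ := Nat.exists_eq_add_of_le' hmew
  have hbound : v ≤ (ψ q).totalDegree + m * d := by
    refine le_trans ?_ (totalDegree_iterate_pderiv_one_le hψ q m)
    rw [← natDegree_homogenize]
    apply Polynomial.le_natDegree_of_ne_zero
    have := coeff_algHom_eq_aeval_weightedHomogeneousComponent (homogenize.comp ψ)
      (d := d) (e := e) (natDegree_homogenize _) (natDegree_homogenize _) (w := v)
      (q := (pderiv 1)^[m] q) (fun s hs => by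
        have := weight_le_of_mem_support_iterate_pderiv_one htmax m s hs
        change _ ≤ w at this
        omega)
    rw [← iterate_pderiv_one_weightedHomogeneousComponent, ← hv] at this
    rw [AlgHom.comp_apply] at this
    rw [this]
    exact hne
  rcases hm with rfl | ⟨c, hc⟩
  · omega
  have ha1 : a ≠ 1 := by
    rintro rfl
    refine absurd (hred₁ c b) (not_le.2 (totalDegree_sub_C_mul_pow_lt he ?_ ?_))
    · rw [← he_def, ← hd_def, heb, hda, one_mul]
    · rw [← hc, pow_one]
  have hb1 : b ≠ 1 := by
    rintro rfl
    refine absurd (hred₀ c⁻¹ a) (not_le.2 (totalDegree_sub_C_mul_pow_lt hd ?_ ?_))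
    · rw [← he_def, ← hd_def, heb, hda, one_mul]
    · rw [hc, pow_one, ← mul_assoc, ← map_mul, inv_mul_cancel₀, map_one, one_mul]
      rintro rfl
      rw [map_zero, zero_mul] at hc
      exact pow_ne_zero _ (hlc 1) hc
  have hab6 : 6 * (a + b) ≤ 5 * (a * b) := by
    have h22 : ¬(a = 2 ∧ b = 2) := by
      rintro ⟨rfl, rfl⟩
      simp at hab
    rcases Nat.lt_or_ge a 3 with h | h
    · obtain rfl : a = 2 := by omega
      omega
    · rcases Nat.lt_or_ge b 3 with h' | h'
      · obtain rfl : b = 2 := by omega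
        omega
      · nlinarith
  have h1 : 6 * (m * d + m * e) ≤ 5 * w := by
    calc 6 * (m * d + m * e) = m * g * (6 * (a + b)) := by rw [hda, heb]; ring
      _ ≤ m * g * (5 * (a * b)) := Nat.mul_le_mul_left _ hab6
      _ = 5 * (a * m * e) := by rw [heb]; ring
      _ ≤ 5 * w := Nat.mul_le_mul_left _ hmw
  omega

/-- The elementary automorphism of `ℂ[x,y]` that sends the variable `i` to
`X i - c * X (1 - i) ^ k` and fixes the other variable. -/
noncomputable def elementaryAut (i : Fin 2) (c : ℂ) (k : ℕ) : P ≃ₐ[ℂ] P :=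
  AlgEquiv.ofAlgHom
    (aeval fun j => if j = i then X i - C c * X (1 - i) ^ k else X j)
    (aeval fun j => if j = i then X i + C c * X (1 - i) ^ k else X j)
    (by ext1 j; fin_cases i <;> fin_cases j <;> simp)
    (by ext1 j; fin_cases i <;> fin_cases j <;> simp)

theorem elementaryAut_X_self (i : Fin 2) (c : ℂ) (k : ℕ) :
    elementaryAut i c k (X i) = X i - C c * X (1 - i) ^ k := by
  simp [elementaryAut]

theorem elementaryAut_X_of_ne {i j : Fin 2} (h : j ≠ i) (c : ℂ) (k : ℕ) :
    elementaryAut i c k (X j) = X j := by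
  simp [elementaryAut, h]

/-- After composing with a suitable automorphism, no elementary automorphism lowers the
degree of the image of a variable. -/
theorem exists_algEquiv_totalDegree_minimal (ψ : P →ₐ[ℂ] P) :
    ∃ τ : P ≃ₐ[ℂ] P,
      (∀ (c : ℂ) (k : ℕ), (ψ (τ (X 0))).totalDegree ≤
        (ψ (τ (X 0)) - C c * ψ (τ (X 1)) ^ k).totalDegree) ∧
      ∀ (c : ℂ) (k : ℕ), (ψ (τ (X 1))).totalDegree ≤
        (ψ (τ (X 1)) - C c * ψ (τ (X 0)) ^ k).totalDegree := by
  let d : (P ≃ₐ[ℂ] P) → ℕ := fun τ =>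
    (ψ (τ (X 0))).totalDegree + (ψ (τ (X 1))).totalDegree
  have hC (τ : P ≃ₐ[ℂ] P) (c : ℂ) : ψ (τ (C c)) = C c := by
    rw [← algebraMap_eq, AlgEquiv.commutes, AlgHom.commutes]
  refine ⟨Function.argmin d, fun c k => ?_, fun c k => ?_⟩
  · have h := Function.argmin_le d ((elementaryAut 0 c k).trans (Function.argmin d))
    simp only [d, AlgEquiv.trans_apply, elementaryAut_X_self, ne_eq, one_ne_zero,
      not_false_eq_true, elementaryAut_X_of_ne, sub_zero, map_sub, map_mul, map_pow, hC] at h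
    exact Nat.le_of_add_le_add_right h
  · have h := Function.argmin_le d ((elementaryAut 1 c k).trans (Function.argmin d))
    simp only [d, AlgEquiv.trans_apply, elementaryAut_X_self, ne_eq, zero_ne_one,
      not_false_eq_true, elementaryAut_X_of_ne, sub_self, map_sub, map_mul, map_pow, hC] at h
    exact Nat.le_of_add_le_add_left h

/-- The image under an automorphism of a polynomial in one variable lies in a proper retract. -/
theorem exists_isProperRetract_of_support (τ : P ≃ₐ[ℂ] P) (i : Fin 2) {q : P}
    (hq : ∀ s ∈ q.support, s i = 0) (hdeg : (τ q).totalDegree ≠ 0) :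
    ∃ R : Subalgebra ℂ P, IsProperRetract R ∧ τ q ∈ R := by
  let ε : P →ₐ[ℂ] P := aeval fun j => if j = i then 0 else X j
  have hε : ε.comp ε = ε := by
    ext1 j
    by_cases h : j = i <;> simp [ε, h]
  have hεq : ε q = q := by
    conv_rhs => rw [← aeval_X_left_apply (R := ℂ) q]
    simp only [ε, aeval_def, eval₂_eq]
    refine Finset.sum_congr rfl fun s hs => ?_
    congr 1
    refine Finset.prod_congr rfl fun j _ => ?_
    by_cases h : j = i
    · simp [h, hq s hs]
    · simp [h]
  let π : P →ₐ[ℂ] P := ((τ : P →ₐ[ℂ] P).comp ε).comp (τ.symm : P →ₐ[ℂ] P)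
  have hπ (a : P) : π (τ a) = τ (ε a) := by simp [π]
  have hππ : π.comp π = π := by
    ext1 j
    obtain ⟨a, ha⟩ := τ.surjective (X j)
    rw [AlgHom.comp_apply, ← ha, hπ, hπ, ← AlgHom.comp_apply ε, hε]
  have hmem : τ q ∈ π.range := ⟨τ q, by simp [hπ, hεq]⟩
  refine ⟨π.range, ⟨⟨π, hππ, rfl⟩, fun h => ?_, fun h => ?_⟩, hmem⟩
  · rw [h, Algebra.mem_bot] at hmem
    obtain ⟨c, hc⟩ := hmem
    exact hdeg (by rw [← hc, algebraMap_eq, totalDegree_C])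
  · obtain ⟨a, ha⟩ : τ (X i) ∈ π.range := h ▸ Algebra.mem_top
    have h0 : τ (X i) = 0 := by
      calc τ (X i) = π (τ (X i)) := by
            have ha : π a = τ (X i) := ha
            rw [← ha, ← AlgHom.comp_apply, hππ]
        _ = 0 := by rw [hπ]; simp [ε]
    exact X_ne_zero i ((map_eq_zero_iff τ τ.injective).mp h0)

/-- The range of an injective endomorphism fixing `p` is generated in degree at most
`6 * p.totalDegree`, unless `p` lies in a proper retract. -/
theorem exists_range_eq_adjoin_totalDegree_le {ψ : P →ₐ[ℂ] P} (hψ : Function.Injective ψ)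
    {p : P} (hp : p.totalDegree ≠ 0) (hfix : ψ p = p)
    (hR : ¬∃ R : Subalgebra ℂ P, IsProperRetract R ∧ p ∈ R) :
    ∃ S : Set P, (∀ f ∈ S, f.totalDegree ≤ 6 * p.totalDegree) ∧
      ψ.range = Algebra.adjoin ℂ S := by
  obtain ⟨τ, h₀, h₁⟩ := exists_algEquiv_totalDegree_minimal ψ
  have hw : ∀ s ∈ (τ.symm p).support, s 0 * (ψ (τ (X 0))).totalDegree +
      s 1 * (ψ (τ (X 1))).totalDegree ≤ 6 * (ψ (τ (τ.symm p))).totalDegree :=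
    weight_le_six_mul_totalDegree (ψ := ψ.comp (τ : P →ₐ[ℂ] P))
      (hψ.comp τ.injective) h₀ h₁ (τ.symm p)
  rw [AlgEquiv.apply_symm_apply, hfix] at hw
  have hex (i : Fin 2) : ∃ s ∈ (τ.symm p).support, s i ≠ 0 := by
    by_contra! h
    have := exists_isProperRetract_of_support τ i h
    rw [AlgEquiv.apply_symm_apply] at this
    exact hR (this hp)
  refine ⟨Set.range fun i => ψ (τ (X i)), ?_, ?_⟩
  · rintro _ ⟨i, rfl⟩
    obtain ⟨s, hs, hsi⟩ := hex i
    have h := hw s hs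
    have hi : (ψ (τ (X i))).totalDegree ≤ s i * (ψ (τ (X i))).totalDegree :=
      Nat.le_mul_of_pos_left _ (Nat.pos_of_ne_zero hsi)
    revert hi
    revert i
    rw [Fin.forall_fin_two]
    constructor <;> intros <;> dsimp only at * <;> omega
  · have h : Set.range (fun i => ψ (τ (X i))) =
        (ψ.comp (τ : P →ₐ[ℂ] P)) '' Set.range (X : Fin 2 → P) := by
      rw [← Set.range_comp]
      rfl
    rw [h, ← AlgHom.map_adjoin, adjoin_range_X, Algebra.map_top]
    ext f
    constructor
    · rintro ⟨a, rfl⟩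
      exact ⟨τ.symm a, by simp⟩
    · rintro ⟨a, rfl⟩
      exact ⟨τ a, rfl⟩

theorem exists_forall_mem_range_pow_succ (φ : P →ₐ[ℂ] P) (N : ℕ) :
    ∃ n, ∀ f ∈ (φ ^ n).range, f.totalDegree ≤ N → f ∈ (φ ^ (n + 1)).range := by
  by_contra! h
  let W : ℕ → Submodule ℂ P := fun n =>
    Subalgebra.toSubmodule (φ ^ n).range ⊓ restrictTotalDegree (Fin 2) ℂ N
  have hfin (n : ℕ) : Module.Finite ℂ (W n) :=
    Submodule.finiteDimensional_of_le (inf_le_right : W n ≤ restrictTotalDegree (Fin 2) ℂ N)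
  have hlt (n : ℕ) : W (n + 1) < W n := by
    refine lt_of_le_not_ge (inf_le_inf_right _ ?_) fun hle => ?_
    · rintro _ ⟨a, rfl⟩
      exact ⟨φ a, by rw [pow_succ]; rfl⟩
    · obtain ⟨f, hf, hfN, hf'⟩ := h n
      exact hf' (hle ⟨hf, (mem_restrictTotalDegree _ _ _).mpr hfN⟩).1
  exact not_strictAnti_of_wellFoundedLT (fun n => Module.finrank ℂ (W n))
    (strictAnti_nat_of_succ_lt fun n => Submodule.finrank_lt_finrank_of_lt (hlt n))

/-- Let `φ` be an injective `ℂ`-algebra endomorphism of `ℂ[x,y]` which is not an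
automorphism.  If `φ(p) = p` for some non-constant polynomial `p`, then `p`
belongs to a proper retract of `ℂ[x,y]`. -/
theorem fixed_poly_in_proper_retract (φ : P →ₐ[ℂ] P)
    (hinj : Function.Injective φ) (hnaut : ¬Function.Bijective φ)
    (p : P) (hp : p.totalDegree ≠ 0) (hfix : φ p = p) :
    ∃ R : Subalgebra ℂ P, IsProperRetract R ∧ p ∈ R := by
  by_contra hR
  have hpow (n : ℕ) : Function.Injective (φ ^ n) ∧ (φ ^ n) p = p := by
    induction n with
    | zero => exact ⟨Function.injective_id, rfl⟩
    | succ n ih =>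
      rw [pow_succ]
      exact ⟨ih.1.comp hinj, (congrArg (φ ^ n) hfix).trans ih.2⟩
  obtain ⟨n, hn⟩ := exists_forall_mem_range_pow_succ φ (6 * p.totalDegree)
  obtain ⟨S, hS, hrange⟩ := exists_range_eq_adjoin_totalDegree_le (hpow n).1 hp (hpow n).2 hR
  have hle : (φ ^ n).range ≤ (φ ^ (n + 1)).range := by
    conv_lhs => rw [hrange]
    exact Algebra.adjoin_le fun f hf =>
      hn f (hrange ▸ Algebra.subset_adjoin hf) (hS f hf)
  refine hnaut ⟨hinj, fun a => ?_⟩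
  obtain ⟨b, hb⟩ := hle ⟨a, rfl⟩
  refine ⟨b, (hpow n).1 ?_⟩
  rw [pow_succ] at hb
  exact hb
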